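/- Let M = {−1,0,1}² and let F : M → L⁴ be discrete isothermic with cross ratio factorizing function a, and suppose the vertex star lifts F_{(0,0)}, F_{(1,0)}, F_{(0,1)}, F_{(−1,0)}, F_{(0,−1)} form a basis of ℝ^5 (the net is non-spherical). Then for every Q ∈ ℝ^5∖{0} there exists a unique map Z : M → ℝ^5 such that λ ↦ λ·Z_i + Q is a polynomial conserved quantity of F of degree ≤ 1 with constant coefficient Q. -/

import Mathlib

noncomputable section

/-- The Minkowski bilinear form of signature (4,1) on `ℝ^5`. -/
def mink (x y : Fin 5 → ℝ) : ℝ :=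
  -(x 0 * y 0) + x 1 * y 1 + x 2 * y 2 + x 3 * y 3 + x 4 * y 4

/-- The light cone `L⁴ ⊂ ℝ^{4,1}`. -/
def LightCone (x : Fin 5 → ℝ) : Prop :=
  x ≠ 0 ∧ mink x x = 0

/-- The map `Γ^q_{p,p'}` of the paper. -/
def Gamma (p p' : Fin 5 → ℝ) (q : ℝ) (X : Fin 5 → ℝ) : Fin 5 → ℝ :=
  X + (1 / mink p p') •
    (((q - 1) * mink X p') • p + ((1 / q - 1) * mink X p) • p')

/-- Two vectors are proportional if one is a scalar multiple of the other. -/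
def Proportional (x y : Fin 5 → ℝ) : Prop :=
  (∃ t : ℝ, y = t • x) ∨ (∃ t : ℝ, x = t • y)

/-- Membership in the rectangular grid `M`. -/
def InGrid (m₁ m₂ n₁ n₂ : ℤ) (i : ℤ × ℤ) : Prop :=
  m₁ ≤ i.1 ∧ i.1 ≤ m₂ ∧ n₁ ≤ i.2 ∧ i.2 ≤ n₂

/-- `(i,j)` is an edge of the grid (in either orientation). -/
def IsEdge (m₁ m₂ n₁ n₂ : ℤ) (i j : ℤ × ℤ) : Prop :=
  InGrid m₁ m₂ n₁ n₂ i ∧ InGrid m₁ m₂ n₁ n₂ j ∧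
    ((j.1 = i.1 + 1 ∧ j.2 = i.2) ∨ (i.1 = j.1 + 1 ∧ i.2 = j.2) ∨
     (j.1 = i.1 ∧ j.2 = i.2 + 1) ∨ (i.1 = j.1 ∧ i.2 = j.2 + 1))

/-- `(i,j,k,l)` is an elementary quadrilateral (face) of the grid. -/
def IsFace (m₁ m₂ n₁ n₂ : ℤ) (i j k l : ℤ × ℤ) : Prop :=
  InGrid m₁ m₂ n₁ n₂ i ∧ InGrid m₁ m₂ n₁ n₂ k ∧
    j = (i.1 + 1, i.2) ∧ k = (i.1 + 1, i.2 + 1) ∧ l = (i.1, i.2 + 1)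

/-- Four vectors are pairwise non-proportional. -/
def FaceRegular (v w x y : Fin 5 → ℝ) : Prop :=
  ¬ Proportional v w ∧ ¬ Proportional v x ∧ ¬ Proportional v y ∧
  ¬ Proportional w x ∧ ¬ Proportional w y ∧ ¬ Proportional x y

/-- A discrete isothermic net (with values in the light cone) with cross ratio
factorizing function `a`. -/
structure IsIsothermic (m₁ m₂ n₁ n₂ : ℤ) (F : ℤ × ℤ → Fin 5 → ℝ)
    (a : ℤ × ℤ → ℤ × ℤ → ℝ) : Prop where
  lightcone : ∀ i, InGrid m₁ m₂ n₁ n₂ i → LightCone (F i)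
  regular : ∀ i j k l, IsFace m₁ m₂ n₁ n₂ i j k l →
    FaceRegular (F i) (F j) (F k) (F l)
  symm : ∀ i j, IsEdge m₁ m₂ n₁ n₂ i j → a i j = a j i
  nonzero : ∀ i j, IsEdge m₁ m₂ n₁ n₂ i j → a i j ≠ 0
  opposite : ∀ i j k l, IsFace m₁ m₂ n₁ n₂ i j k l →
    a i j = a l k ∧ a i l = a j k
  cross : ∀ i j k l, IsFace m₁ m₂ n₁ n₂ i j k l →
    ∃ t : ℝ, t ≠ 0 ∧ F k = t • Gamma (F j) (F l) (a i j / a i l) (F i)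

/-- Evaluation of the polynomial with vector coefficients `P i 0, …, P i N`
at the spectral parameter `lam`. -/
def pcqEval (N : ℕ) (P : ℤ × ℤ → ℕ → Fin 5 → ℝ) (i : ℤ × ℤ) (lam : ℝ) :
    Fin 5 → ℝ :=
  ∑ k ∈ Finset.range (N + 1), lam ^ k • P i k

/-- `P` is a polynomial conserved quantity of degree at most `N` of the net `F`
with cross ratio factorizing function `a`. -/
def IsPCQ (m₁ m₂ n₁ n₂ : ℤ) (F : ℤ × ℤ → Fin 5 → ℝ) (a : ℤ × ℤ → ℤ × ℤ → ℝ)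
    (N : ℕ) (P : ℤ × ℤ → ℕ → Fin 5 → ℝ) : Prop :=
  ∀ i j, IsEdge m₁ m₂ n₁ n₂ i j → ∀ lam : ℝ, lam * a i j ≠ 1 →
    pcqEval N P i lam = Gamma (F i) (F j) (1 - lam * a i j) (pcqEval N P j lam)

/-- A polynomial conserved quantity is normalized (of degree `N`) if its top
coefficient has Minkowski square norm one at every vertex. -/
def Normalized (m₁ m₂ n₁ n₂ : ℤ) (N : ℕ) (P : ℤ × ℤ → ℕ → Fin 5 → ℝ) : Prop :=
  ∀ i, InGrid m₁ m₂ n₁ n₂ i → mink (P i N) (P i N) = 1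

/-- A Darboux transform of `F` with parameter `μ`. -/
def IsDarboux (m₁ m₂ n₁ n₂ : ℤ) (F : ℤ × ℤ → Fin 5 → ℝ) (a : ℤ × ℤ → ℤ × ℤ → ℝ)
    (μ : ℝ) (Fh : ℤ × ℤ → Fin 5 → ℝ) : Prop :=
  (∀ i, InGrid m₁ m₂ n₁ n₂ i → LightCone (Fh i)) ∧
  (∀ i, InGrid m₁ m₂ n₁ n₂ i → ¬ Proportional (F i) (Fh i)) ∧
  (∀ i j, IsEdge m₁ m₂ n₁ n₂ i j → Fh i = Gamma (F i) (F j) (1 - μ * a i j) (Fh j))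

/-- A Calapso transformation of `F` at parameter `μ`: a vertexwise family of
linear isometries of `ℝ^{4,1}` gauging the isothermic connection at `μ` to the
trivial connection. -/
def IsCalapso (m₁ m₂ n₁ n₂ : ℤ) (F : ℤ × ℤ → Fin 5 → ℝ) (a : ℤ × ℤ → ℤ × ℤ → ℝ)
    (μ : ℝ) (T : ℤ × ℤ → (Fin 5 → ℝ) → (Fin 5 → ℝ)) : Prop :=
  (∀ i, InGrid m₁ m₂ n₁ n₂ i → IsLinearMap ℝ (T i)) ∧
  (∀ i, InGrid m₁ m₂ n₁ n₂ i → ∀ x y, mink (T i x) (T i y) = mink x y) ∧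
  (∀ i j, IsEdge m₁ m₂ n₁ n₂ i j → ∀ x,
    T j x = T i (Gamma (F i) (F j) (1 - μ * a i j) x))

lemma mink_comm' (x y : Fin 5 → ℝ) : mink x y = mink y x := by simp only [mink]; ring
lemma mink_add_l (x y z : Fin 5 → ℝ) : mink (x + y) z = mink x z + mink y z := by
  simp only [mink, Pi.add_apply]; ring
lemma mink_sub_l (x y z : Fin 5 → ℝ) : mink (x - y) z = mink x z - mink y z := by
  simp only [mink, Pi.sub_apply]; ring
lemma mink_smul_l (c : ℝ) (x z : Fin 5 → ℝ) : mink (c • x) z = c * mink x z := by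
  simp only [mink, Pi.smul_apply, smul_eq_mul]; ring
lemma mink_add_r (x y z : Fin 5 → ℝ) : mink z (x + y) = mink z x + mink z y := by
  simp only [mink, Pi.add_apply]; ring
lemma mink_sub_r (x y z : Fin 5 → ℝ) : mink z (x - y) = mink z x - mink z y := by
  simp only [mink, Pi.sub_apply]; ring
lemma mink_smul_r (c : ℝ) (x z : Fin 5 → ℝ) : mink z (c • x) = c * mink z x := by
  simp only [mink, Pi.smul_apply, smul_eq_mul]; ring

lemma null_zero (x : Fin 5 → ℝ) (h0 : x 0 = 0) (h : mink x x = 0) : x = 0 := by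
  simp only [mink, h0] at h
  have h1 : x 1 = 0 := by nlinarith [sq_nonneg (x 1), sq_nonneg (x 2), sq_nonneg (x 3), sq_nonneg (x 4)]
  have h2 : x 2 = 0 := by nlinarith [sq_nonneg (x 1), sq_nonneg (x 2), sq_nonneg (x 3), sq_nonneg (x 4)]
  have h3 : x 3 = 0 := by nlinarith [sq_nonneg (x 1), sq_nonneg (x 2), sq_nonneg (x 3), sq_nonneg (x 4)]
  have h4 : x 4 = 0 := by nlinarith [sq_nonneg (x 1), sq_nonneg (x 2), sq_nonneg (x 3), sq_nonneg (x 4)]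
  ext i; fin_cases i <;> simp [h0, h1, h2, h3, h4]

lemma mink_ne (x y : Fin 5 → ℝ) (hx : LightCone x) (hy : LightCone y)
    (h : ¬ Proportional x y) : mink x y ≠ 0 := by
  intro h0
  apply h
  have hx0 : x 0 ≠ 0 := fun e => hx.1 (null_zero x e hx.2)
  left
  refine ⟨y 0 / x 0, ?_⟩
  have : x 0 • y - y 0 • x = 0 := by
    apply null_zero
    · simp; ring
    · simp only [mink_sub_l, mink_sub_r, mink_smul_l, mink_smul_r, hx.2, hy.2, mink_comm' y x, h0]
      ring
  have h2 : x 0 • y = y 0 • x := sub_eq_zero.mp this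
  rw [div_eq_inv_mul, mul_smul, ← h2, smul_smul, inv_mul_cancel₀ hx0, one_smul]

/-- Data of a face seen from the vertex `i`. -/
structure FaceD (i j k l : Fin 5 → ℝ) (a b : ℝ) : Prop where
  ii : mink i i = 0
  jj : mink j j = 0
  kk : mink k k = 0
  ll : mink l l = 0
  ij : mink i j ≠ 0
  ik : mink i k ≠ 0
  il : mink i l ≠ 0
  jk : mink j k ≠ 0
  jl : mink j l ≠ 0
  kl : mink k l ≠ 0
  a0 : a ≠ 0
  b0 : b ≠ 0
  cr : ∃ t : ℝ, t ≠ 0 ∧ k = t • Gamma j l (a / b) i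

lemma FaceD.rot {i j k l : Fin 5 → ℝ} {a b : ℝ} (h : FaceD i j k l a b) :
    FaceD j k l i b a := by
  obtain ⟨hii, hjj, hkk, hll, hij, hik, hil, hjk, hjl, hkl, ha, hb, t, ht, hk⟩ := h
  refine ⟨hjj, hkk, hll, hii, hjk, hjl, by rwa [mink_comm'], hkl, by rwa [mink_comm'],
    by rwa [mink_comm'], hb, ha, (a / b) * mink i l / mink i j, by positivity, ?_⟩
  have ejk : mink j k = t * mink i j * b / a := by
    rw [hk, Gamma]
    simp only [mink_add_r, mink_smul_r, hjj, mink_comm' j i]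
    field_simp
    ring
  have eki : mink k i = t * mink i j * mink i l / mink j l * ((a - b) ^ 2 / (a * b)) := by
    rw [hk, Gamma]
    simp only [mink_add_l, mink_smul_l, hii, mink_comm' j i, mink_comm' l i]
    field_simp
    ring
  have hab : a - b ≠ 0 := by
    intro e
    apply hik
    rw [mink_comm', eki, e]; simp
  rw [Gamma, ejk, eki]
  rw [mink_comm' j i, hk, Gamma]
  ext x
  simp only [Pi.add_apply, Pi.smul_apply, smul_eq_mul]
  field_simp
  ring

lemma FaceD.swap {i j k l : Fin 5 → ℝ} {a b : ℝ} (h : FaceD i j k l a b) :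
    FaceD i l k j b a := by
  obtain ⟨hii, hjj, hkk, hll, hij, hik, hil, hjk, hjl, hkl, ha, hb, t, ht, hk⟩ := h
  refine ⟨hii, hll, hkk, hjj, hil, hik, hij, by rwa [mink_comm'], by rwa [mink_comm'],
    by rwa [mink_comm'], hb, ha, t, ht, ?_⟩
  rw [hk, Gamma, Gamma, mink_comm' l j]
  ext x
  simp only [Pi.add_apply, Pi.smul_apply, smul_eq_mul]
  field_simp
  ring

/-- Reduced edge condition. -/
structure EdgeOK (Q i j : Fin 5 → ℝ) (a : ℝ) (zi zj : Fin 5 → ℝ) : Prop where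
  h1 : mink zj j = 0
  h2 : mink zj i = -(a * mink Q i)
  h3 : zi = zj + (a / mink i j) • (mink Q i • j - mink Q j • i)

lemma EdgeOK.symm' {Q i j : Fin 5 → ℝ} {a : ℝ} {zi zj : Fin 5 → ℝ} (h : EdgeOK Q i j a zi zj)
    (hi : mink i i = 0) (hj : mink j j = 0) (hij : mink i j ≠ 0) : EdgeOK Q j i a zj zi := by
  obtain ⟨h1, h2, h3⟩ := h
  refine ⟨?_, ?_, ?_⟩
  · rw [h3]
    simp only [mink_add_l, mink_smul_l, mink_sub_l, hi, h2, mink_comm' j i]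
    field_simp; ring
  · rw [h3]
    simp only [mink_add_l, mink_smul_l, mink_sub_l, hj, h1]
    field_simp; ring
  · rw [h3, mink_comm' j i]
    ext x
    simp only [Pi.add_apply, Pi.smul_apply, Pi.sub_apply, smul_eq_mul]
    ring

lemma EdgeOK.pcq {Q i j : Fin 5 → ℝ} {a : ℝ} {zi zj : Fin 5 → ℝ} (h : EdgeOK Q i j a zi zj)
    (hij : mink i j ≠ 0) (lam : ℝ) (hl : lam * a ≠ 1) :
    Q + lam • zi = Gamma i j (1 - lam * a) (Q + lam • zj) := by
  obtain ⟨h1, h2, h3⟩ := h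
  have hl' : 1 - lam * a ≠ 0 := sub_ne_zero.mpr (Ne.symm hl)
  rw [h3, Gamma]
  simp only [mink_add_l, mink_smul_l, h1, h2]
  ext x
  simp only [Pi.add_apply, Pi.smul_apply, Pi.sub_apply, smul_eq_mul]
  field_simp
  ring

lemma pcq_nec {Q i j : Fin 5 → ℝ} {a : ℝ} {zi zj : Fin 5 → ℝ}
    (hi : mink i i = 0) (hj : mink j j = 0) (hij : mink i j ≠ 0) (ha : a ≠ 0)
    (h : ∀ lam : ℝ, lam * a ≠ 1 → Q + lam • zi = Gamma i j (1 - lam * a) (Q + lam • zj)) :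
    mink zj j = 0 ∧ mink zj i = -(a * mink Q i) := by
  have e (s : ℝ) (hs : s ≠ 1) (hs0 : s ≠ 0) :
      mink zi j = mink zj j - a * (mink Q j + s / a * mink zj j) ∧
      (1 - s) * mink zi i = (1 - s) * mink zj i + a * (mink Q i + s / a * mink zj i) := by
    have hs' : 1 - s ≠ 0 := sub_ne_zero.mpr (Ne.symm hs)
    have hsa : s / a * a = s := by field_simp
    have h := h (s / a) (by rwa [hsa])
    rw [hsa] at h
    constructor
    · have := congrArg (fun v => mink v j) h
      simp only [Gamma, mink_add_l, mink_smul_l, hj] at this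
      field_simp at this
      have h2 : (mink i j * (1 - s) * s) * (mink zi j - (mink zj j - a * (mink Q j + s / a * mink zj j))) = 0 := by
        have e1 : a * (s / a) = s := by field_simp
        linear_combination this + (mink i j * (1 - s) * s * mink zj j) * e1
      rcases mul_eq_zero.mp h2 with h3 | h3
      · exact absurd h3 (by positivity)
      · linarith
    · have := congrArg (fun v => mink v i) h
      simp only [Gamma, mink_add_l, mink_smul_l, hi, mink_comm' j i] at this
      field_simp at this
      have h2 : (mink i j * s) * ((1 - s) * mink zi i - ((1 - s) * mink zj i + a * (mink Q i + s / a * mink zj i))) = 0 := by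
        have e1 : a * (s / a) = s := by field_simp
        linear_combination this + (-(mink i j * s * mink zj i)) * e1
      rcases mul_eq_zero.mp h2 with h3 | h3
      · exact absurd h3 (by positivity)
      · linarith
  obtain ⟨p1, q1⟩ := e 2 (by norm_num) (by norm_num)
  obtain ⟨p2, q2⟩ := e (-1) (by norm_num) (by norm_num)
  field_simp at p1 q1 p2 q2
  constructor
  · linarith
  · linarith

lemma face_edge {Q i j k l : Fin 5 → ℝ} {a b : ℝ} (h : FaceD i j k l a b) (z : Fin 5 → ℝ)
    (zi : mink z i = 0) (zj : mink z j = -(a * mink Q j)) (zl : mink z l = -(b * mink Q l)) :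
    EdgeOK Q k j b (z + ((b - a) / mink j l) • (mink Q l • j - mink Q j • l))
      (z + (a / mink i j) • (mink Q j • i - mink Q i • j)) := by
  obtain ⟨hii, hjj, hkk, hll, hij, hik, hil, hjk, hjl, hkl, ha, hb, t, ht, hk⟩ := h
  have ejk : mink k j = t * mink i j * b / a := by
    rw [hk, Gamma]
    simp only [mink_add_l, mink_smul_l, hjj, mink_comm' l j]
    field_simp
    ring
  refine ⟨?_, ?_, ?_⟩
  · simp only [mink_add_l, mink_smul_l, mink_sub_l, hjj, zj]
    field_simp; ring
  · rw [hk, Gamma]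
    simp only [mink_add_l, mink_smul_l, mink_sub_l, mink_add_r, mink_smul_r, hii, hjj, zi, zj, zl,
      mink_comm' j i]
    field_simp; ring
  · rw [ejk, hk, Gamma]
    simp only [mink_add_r, mink_smul_r]
    ext x
    simp only [Pi.add_apply, Pi.smul_apply, Pi.sub_apply, smul_eq_mul]
    field_simp
    ring

lemma exists_dual (v : Fin 5 → Fin 5 → ℝ) (hv : LinearIndependent ℝ v) :
    (∀ c : Fin 5 → ℝ, ∃ z, ∀ n, mink z (v n) = c n) ∧
    ∀ z z', (∀ n, mink z (v n) = mink z' (v n)) → z = z' := by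
  let T : (Fin 5 → ℝ) →ₗ[ℝ] (Fin 5 → ℝ) :=
    { toFun := fun z n => mink z (v n)
      map_add' := by intro x y; ext n; simp [mink_add_l]
      map_smul' := by intro c x; ext n; simp [mink_smul_l] }
  have hinj : Function.Injective T := by
    rw [injective_iff_map_eq_zero]
    intro z hz
    have hz' : ∀ n, mink z (v n) = 0 := fun n => congrFun hz n
    have hsp : Submodule.span ℝ (Set.range v) = ⊤ :=
      hv.span_eq_top_of_card_eq_finrank (by simp)
    have hall : ∀ y, mink z y = 0 := by
      intro y
      have hy : y ∈ Submodule.span ℝ (Set.range v) := by rw [hsp]; trivial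
      induction hy using Submodule.span_induction with
      | mem x hx => obtain ⟨n, rfl⟩ := hx; exact hz' n
      | zero => simp [mink]
      | add x y _ _ hx hy => rw [mink_add_r, hx, hy, add_zero]
      | smul c x _ hx => rw [mink_smul_r, hx, mul_zero]
    ext n
    have := hall (Pi.single n 1)
    fin_cases n <;> simpa [mink, Pi.single_apply] using this
  constructor
  · intro c
    obtain ⟨z, hz⟩ := (LinearMap.injective_iff_surjective.mp hinj) c
    exact ⟨z, fun n => congrFun hz n⟩
  · intro z z' h
    exact hinj (funext h)

lemma pcqEval_one (Q : Fin 5 → ℝ) (Z : ℤ × ℤ → Fin 5 → ℝ) (i : ℤ × ℤ) (lam : ℝ) :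
    pcqEval 1 (fun i k => if k = 0 then Q else if k = 1 then Z i else 0) i lam
      = Q + lam • Z i := by
  simp [pcqEval, Finset.sum_range_succ]

lemma face_data {F : ℤ × ℤ → Fin 5 → ℝ} {a : ℤ × ℤ → ℤ × ℤ → ℝ}
    (hiso : IsIsothermic (-1) 1 (-1) 1 F a) (x y : ℤ) (hx : -1 ≤ x) (hx' : x ≤ 0)
    (hy : -1 ≤ y) (hy' : y ≤ 0) :
    FaceD (F (x, y)) (F (x + 1, y)) (F (x + 1, y + 1)) (F (x, y + 1))
      (a (x, y) (x + 1, y)) (a (x, y) (x, y + 1)) := by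
  have hf : IsFace (-1) 1 (-1) 1 (x, y) (x + 1, y) (x + 1, y + 1) (x, y + 1) := by
    refine ⟨?_, ?_, rfl, rfl, rfl⟩ <;> simp only [InGrid] <;> omega
  have hi := hiso.lightcone (x, y) (by simp only [InGrid]; omega)
  have hj := hiso.lightcone (x + 1, y) (by simp only [InGrid]; omega)
  have hk := hiso.lightcone (x + 1, y + 1) (by simp only [InGrid]; omega)
  have hl := hiso.lightcone (x, y + 1) (by simp only [InGrid]; omega)
  obtain ⟨r1, r2, r3, r4, r5, r6⟩ := hiso.regular _ _ _ _ hf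
  exact ⟨hi.2, hj.2, hk.2, hl.2, mink_ne _ _ hi hj r1, mink_ne _ _ hi hk r2, mink_ne _ _ hi hl r3,
    mink_ne _ _ hj hk r4, mink_ne _ _ hj hl r5, mink_ne _ _ hk hl r6,
    hiso.nonzero _ _ (by simp only [IsEdge, InGrid]; simp; omega),
    hiso.nonzero _ _ (by simp only [IsEdge, InGrid]; simp; omega),
    hiso.cross _ _ _ _ hf⟩

/-- The face with center `(0,0)` and opposite corner `(x,y)`. -/
lemma center_face {F : ℤ × ℤ → Fin 5 → ℝ} {a : ℤ × ℤ → ℤ × ℤ → ℝ}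
    (hiso : IsIsothermic (-1) 1 (-1) 1 F a) (x y : ℤ) (hx : x = 1 ∨ x = -1)
    (hy : y = 1 ∨ y = -1) :
    FaceD (F (0, 0)) (F (x, 0)) (F (x, y)) (F (0, y)) (a (0, 0) (x, 0)) (a (0, 0) (0, y)) ∧
    a (x, y) (x, 0) = a (0, 0) (0, y) ∧ a (x, y) (0, y) = a (0, 0) (x, 0) := by
  have hs : ∀ i j, IsEdge (-1) 1 (-1) 1 i j → a i j = a j i := hiso.symm
  have ho : ∀ x y : ℤ, -1 ≤ x → x ≤ 0 → -1 ≤ y → y ≤ 0 →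
      a (x, y) (x + 1, y) = a (x, y + 1) (x + 1, y + 1) ∧
      a (x, y) (x, y + 1) = a (x + 1, y) (x + 1, y + 1) := by
    intro x y _ _ _ _
    apply hiso.opposite _ _ _ _
    refine ⟨?_, ?_, rfl, rfl, rfl⟩ <;> simp only [InGrid] <;> omega
  have s1 := hs (0, 0) (1, 0) (by simp [IsEdge, InGrid])
  have s2 := hs (0, 0) (0, 1) (by simp [IsEdge, InGrid])
  have s3 := hs (0, 0) (-1, 0) (by simp [IsEdge, InGrid])
  have s4 := hs (0, 0) (0, -1) (by simp [IsEdge, InGrid])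
  rcases hx with rfl | rfl <;> rcases hy with rfl | rfl
  · have h := face_data hiso 0 0 (by norm_num) (by norm_num) (by norm_num) (by norm_num)
    obtain ⟨o1, o2⟩ := ho 0 0 (by norm_num) (by norm_num) (by norm_num) (by norm_num)
    have t1 := hs (1, 0) (1, 1) (by simp [IsEdge, InGrid])
    have t2 := hs (0, 1) (1, 1) (by simp [IsEdge, InGrid])
    norm_num at h o1 o2
    exact ⟨h, by rw [← t1, o2], by rw [← t2, o1]⟩
  · have h := face_data hiso 0 (-1) (by norm_num) (by norm_num) (by norm_num) (by norm_num)
    obtain ⟨o1, o2⟩ := ho 0 (-1) (by norm_num) (by norm_num) (by norm_num) (by norm_num)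
    have t2 := hs (0, -1) (1, -1) (by simp [IsEdge, InGrid])
    norm_num at h o1 o2
    have h' := h.rot.rot.rot.swap
    rw [o1, ← s4] at h'
    exact ⟨h', by rw [← o2, s4], by rw [← t2, o1]⟩
  · have h := face_data hiso (-1) 0 (by norm_num) (by norm_num) (by norm_num) (by norm_num)
    obtain ⟨o1, o2⟩ := ho (-1) 0 (by norm_num) (by norm_num) (by norm_num) (by norm_num)
    have t1 := hs (-1, 0) (-1, 1) (by simp [IsEdge, InGrid])
    norm_num at h o1 o2
    have h' := h.rot.swap
    rw [o2, ← s3] at h'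
    exact ⟨h', by rw [← t1, o2], by rw [← o1, s3]⟩
  · have h := face_data hiso (-1) (-1) (by norm_num) (by norm_num) (by norm_num) (by norm_num)
    obtain ⟨o1, o2⟩ := ho (-1) (-1) (by norm_num) (by norm_num) (by norm_num) (by norm_num)
    norm_num at h o1 o2
    have h' := h.rot.rot
    rw [o1, o2, ← s3, ← s4] at h'
    exact ⟨h', by rw [o2, s4], by rw [o1, s3]⟩

/-- on the 3×3 grid `{-1,0,1}²`, a non-spherical discrete
isothermic net has, for every `Q ≠ 0`, a unique linear conserved quantity
`λ·Z + Q` with constant coefficient `Q`. -/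
theorem statement18 (F : ℤ × ℤ → Fin 5 → ℝ) (a : ℤ × ℤ → ℤ × ℤ → ℝ)
    (hiso : IsIsothermic (-1) 1 (-1) 1 F a)
    (hbasis : LinearIndependent ℝ
      ![F (0, 0), F (1, 0), F (0, 1), F (-1, 0), F (0, -1)])
    (Q : Fin 5 → ℝ) (hQ : Q ≠ 0) :
    ∃ Z : ℤ × ℤ → Fin 5 → ℝ,
      IsPCQ (-1) 1 (-1) 1 F a 1
        (fun i k => if k = 0 then Q else if k = 1 then Z i else 0) ∧
      ∀ Z' : ℤ × ℤ → Fin 5 → ℝ,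
        IsPCQ (-1) 1 (-1) 1 F a 1
          (fun i k => if k = 0 then Q else if k = 1 then Z' i else 0) →
        ∀ i, InGrid (-1) 1 (-1) 1 i → Z' i = Z i := by
  classical
  obtain ⟨hex, huniq⟩ := exists_dual _ hbasis
  have hlc := hiso.lightcone
  -- every edge has nonzero product
  have f11 := center_face hiso 1 1 (Or.inl rfl) (Or.inl rfl)
  have f1m := center_face hiso 1 (-1) (Or.inl rfl) (Or.inr rfl)
  have fm1 := center_face hiso (-1) 1 (Or.inr rfl) (Or.inl rfl)
  have fmm := center_face hiso (-1) (-1) (Or.inr rfl) (Or.inr rfl)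
  -- uniqueness propagation along an edge
  have hprop : ∀ Z Z' : ℤ × ℤ → Fin 5 → ℝ,
      IsPCQ (-1) 1 (-1) 1 F a 1 (fun i k => if k = 0 then Q else if k = 1 then Z i else 0) →
      IsPCQ (-1) 1 (-1) 1 F a 1 (fun i k => if k = 0 then Q else if k = 1 then Z' i else 0) →
      ∀ i j, IsEdge (-1) 1 (-1) 1 i j → Z' j = Z j → Z' i = Z i := by
    intro Z Z' h h' i j hij e
    have ha := hiso.nonzero i j hij
    have hl : (-1 / a i j) * a i j ≠ 1 := by
      rw [div_mul_cancel₀ _ ha]; norm_num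
    have h1 := h i j hij _ hl
    have h2 := h' i j hij _ hl
    rw [pcqEval_one, pcqEval_one] at h1 h2
    rw [e, ← h1] at h2
    have h3 := add_left_cancel h2
    exact smul_right_injective _ (div_ne_zero (by norm_num) ha) h3
  -- necessary conditions at the center
  have hnec : ∀ Z : ℤ × ℤ → Fin 5 → ℝ,
      IsPCQ (-1) 1 (-1) 1 F a 1 (fun i k => if k = 0 then Q else if k = 1 then Z i else 0) →
      ∀ i, IsEdge (-1) 1 (-1) 1 i (0, 0) → mink (F i) (F (0, 0)) ≠ 0 →
      mink (Z (0, 0)) (F (0, 0)) = 0 ∧ mink (Z (0, 0)) (F i) = -(a i (0, 0) * mink Q (F i)) := by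
    intro Z h i hi hne
    refine pcq_nec (zi := Z i) (hlc _ hi.1).2 (hlc _ hi.2.1).2 hne (hiso.nonzero _ _ hi) ?_
    intro lam hlam
    have := h i (0, 0) hi lam hlam
    rwa [pcqEval_one, pcqEval_one] at this
  obtain ⟨z, hz⟩ := hex ![0, -(a (0, 0) (1, 0) * mink Q (F (1, 0))),
    -(a (0, 0) (0, 1) * mink Q (F (0, 1))), -(a (0, 0) (-1, 0) * mink Q (F (-1, 0))),
    -(a (0, 0) (0, -1) * mink Q (F (0, -1)))]
  have z0 : mink z (F (0, 0)) = 0 := hz 0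
  have z1 : mink z (F (1, 0)) = -(a (0, 0) (1, 0) * mink Q (F (1, 0))) := hz 1
  have z2 : mink z (F (0, 1)) = -(a (0, 0) (0, 1) * mink Q (F (0, 1))) := hz 2
  have z3 : mink z (F (-1, 0)) = -(a (0, 0) (-1, 0) * mink Q (F (-1, 0))) := hz 3
  have z4 : mink z (F (0, -1)) = -(a (0, 0) (0, -1) * mink Q (F (0, -1))) := hz 4
  let Z : ℤ × ℤ → Fin 5 → ℝ := fun p =>
    if p.1 = 0 ∨ p.2 = 0 then
      z + (a (0, 0) p / mink (F (0, 0)) (F p)) •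
        (mink Q (F p) • F (0, 0) - mink Q (F (0, 0)) • F p)
    else z + ((a (0, 0) (0, p.2) - a (0, 0) (p.1, 0)) / mink (F (p.1, 0)) (F (0, p.2))) •
      (mink Q (F (0, p.2)) • F (p.1, 0) - mink Q (F (p.1, 0)) • F (0, p.2))
  let OK : ℤ × ℤ → ℤ × ℤ → Prop := fun i j =>
    EdgeOK Q (F i) (F j) (a i j) (Z i) (Z j) ∧ mink (F i) (F j) ≠ 0
  have hsymm : ∀ i j, IsEdge (-1) 1 (-1) 1 i j → OK i j → OK j i := by
    rintro i j h ⟨h1, h2⟩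
    refine ⟨?_, by rwa [mink_comm']⟩
    rw [← hiso.symm i j h]
    exact h1.symm' (hlc _ h.1).2 (hlc _ h.2.1).2 h2
  have Z0 : Z (0, 0) = z := by simp [Z]
  have star : ∀ p : ℤ × ℤ, p.1 = 0 ∨ p.2 = 0 → a (0, 0) p = a p (0, 0) →
      mink (F (0, 0)) (F p) ≠ 0 → mink z (F p) = -(a (0, 0) p * mink Q (F p)) →
      OK p (0, 0) := by
    intro p hp hs hne hzp
    refine ⟨⟨?_, ?_, ?_⟩, by rwa [mink_comm']⟩
    · rw [Z0, z0]
    · rw [Z0, hzp, hs]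
    · rw [Z0, mink_comm' (F p), ← hs]
      simp only [Z]
      rw [if_pos hp]
  have corner : ∀ x y : ℤ, (x = 1 ∨ x = -1) → (y = 1 ∨ y = -1) →
      mink z (F (x, 0)) = -(a (0, 0) (x, 0) * mink Q (F (x, 0))) →
      mink z (F (0, y)) = -(a (0, 0) (0, y) * mink Q (F (0, y))) →
      OK (x, y) (x, 0) ∧ OK (x, y) (0, y) := by
    intro x y hx hy hzx hzy
    obtain ⟨hf, e1, e2⟩ := center_face hiso x y hx hy
    have hxy : ¬ (x = 0 ∨ y = 0) := by omega
    refine ⟨⟨?_, by rw [mink_comm']; exact hf.jk⟩, ⟨?_, hf.kl⟩⟩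
    · rw [e1]
      have := face_edge hf z z0 hzx hzy
      simp only [Z]
      rw [if_neg hxy, if_pos (Or.inr trivial)]
      exact this
    · rw [e2]
      have := face_edge hf.swap z z0 hzy hzx
      simp only [Z]
      rw [if_neg hxy, if_pos (Or.inl trivial)]
      convert this using 1
      rw [mink_comm' (F (0, y)) (F (x, 0))]
      ext n
      simp only [Pi.add_apply, Pi.smul_apply, Pi.sub_apply, smul_eq_mul]
      ring
  have s1 := star (1, 0) (Or.inr rfl) (hiso.symm _ _ (by simp [IsEdge, InGrid])) f11.1.ij z1
  have s2 := star (0, 1) (Or.inl rfl) (hiso.symm _ _ (by simp [IsEdge, InGrid])) f11.1.il z2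
  have s3 := star (-1, 0) (Or.inr rfl) (hiso.symm _ _ (by simp [IsEdge, InGrid])) fmm.1.ij z3
  have s4 := star (0, -1) (Or.inl rfl) (hiso.symm _ _ (by simp [IsEdge, InGrid])) fmm.1.il z4
  obtain ⟨c1, c2⟩ := corner 1 1 (by simp) (by simp) z1 z2
  obtain ⟨c3, c4⟩ := corner 1 (-1) (by simp) (by simp) z1 z4
  obtain ⟨c5, c6⟩ := corner (-1) 1 (by simp) (by simp) z3 z2
  obtain ⟨c7, c8⟩ := corner (-1) (-1) (by simp) (by simp) z3 z4
  have hall : ∀ i j, IsEdge (-1) 1 (-1) 1 i j → OK i j := by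
    have key : ∀ x y : ℤ, -1 ≤ x → x ≤ 1 → -1 ≤ y → y ≤ 1 →
        (x ≤ 0 → OK (x, y) (x + 1, y)) ∧ (y ≤ 0 → OK (x, y) (x, y + 1)) := by
      intro x y h1 h2 h3 h4
      have hs : ∀ i j, OK i j → IsEdge (-1) 1 (-1) 1 i j → OK j i := fun i j h h' => hsymm i j h' h
      interval_cases x <;> interval_cases y <;> constructor <;> intro h <;>
        first
        | (exfalso; omega)
        | assumption
        | (refine hs _ _ ?_ ?_
           · assumption
           · simp [IsEdge, InGrid])
    rintro ⟨x, y⟩ ⟨x', y'⟩ h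
    have h' := h
    obtain ⟨hi, hj, hh⟩ := h
    simp only [InGrid] at hi hj hh
    rcases hh with ⟨rfl, rfl⟩ | ⟨rfl, rfl⟩ | ⟨rfl, rfl⟩ | ⟨rfl, rfl⟩
    · exact (key x y' (by omega) (by omega) (by omega) (by omega)).1 (by omega)
    · refine hsymm _ _ ?_ ((key x' y (by omega) (by omega) (by omega) (by omega)).1 (by omega))
      simp only [IsEdge, InGrid]; simp; omega
    · exact (key x' y (by omega) (by omega) (by omega) (by omega)).2 (by omega)
    · refine hsymm _ _ ?_ ((key x y' (by omega) (by omega) (by omega) (by omega)).2 (by omega))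
      simp only [IsEdge, InGrid]; simp; omega
  have hZ : IsPCQ (-1) 1 (-1) 1 F a 1
      (fun i k => if k = 0 then Q else if k = 1 then Z i else 0) := by
    intro i j hij lam hlam
    rw [pcqEval_one, pcqEval_one]
    exact (hall i j hij).1.pcq (hall i j hij).2 lam hlam
  refine ⟨Z, hZ, ?_⟩
  intro Z' hZ'
  have e0 : Z' (0, 0) = Z (0, 0) := by
    apply huniq
    have hn : ∀ p, IsEdge (-1) 1 (-1) 1 p (0, 0) →
        mink (Z' (0, 0)) (F (0, 0)) = mink (Z (0, 0)) (F (0, 0)) ∧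
        mink (Z' (0, 0)) (F p) = mink (Z (0, 0)) (F p) := by
      intro p hp
      have h1 := hnec Z hZ p hp (hall _ _ hp).2
      have h2 := hnec Z' hZ' p hp (hall _ _ hp).2
      exact ⟨by rw [h1.1, h2.1], by rw [h1.2, h2.2]⟩
    intro n
    fin_cases n
    · exact (hn (1, 0) (by simp [IsEdge, InGrid])).1
    · exact (hn (1, 0) (by simp [IsEdge, InGrid])).2
    · exact (hn (0, 1) (by simp [IsEdge, InGrid])).2
    · exact (hn (-1, 0) (by simp [IsEdge, InGrid])).2
    · exact (hn (0, -1) (by simp [IsEdge, InGrid])).2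
  have hp := hprop Z Z' hZ hZ'
  have e1 : ∀ x : ℤ, -1 ≤ x → x ≤ 1 → Z' (x, 0) = Z (x, 0) := by
    intro x h1 h2
    by_cases hx : x = 0
    · rw [hx, e0]
    · refine hp (x, 0) (0, 0) ?_ e0
      simp only [IsEdge, InGrid]; simp; omega
  rintro ⟨x, y⟩ hi
  simp only [InGrid] at hi
  by_cases hy : y = 0
  · rw [hy]; exact e1 x hi.1 hi.2.1
  · refine hp (x, y) (x, 0) ?_ (e1 x hi.1 hi.2.1)
    simp only [IsEdge, InGrid]; simp; omega
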